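/- For every integer n ≥ 1, the central binomial coefficient satisfies binom(2n, n) = Σ_{s=0}^{n−1} C(n−1, s)·2^{n−s}, where C(n−1,s) denotes the Catalan triangle number; consequently Σ_{s=0}^{n−1} C(n−1, s)·2^{n−s} = Σ_{s=0}^{n} binom(n,s)^2. -/

import Mathlib

/-- The Catalan triangle numbers: `C(n,k) = (n+k)! * (n-k+1) / (k! * (n+1)!)`,
with `C(n,k) = 0` for `k > n` (via truncated subtraction). -/
def catalanTriangle (n k : ℕ) : ℕ :=
  (n + k).factorial * (n + 1 - k) / (k.factorial * (n + 1).factorial)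

theorem ct_zero (m : ℕ) : catalanTriangle m 0 = 1 := by
  unfold catalanTriangle
  have h : m.factorial * (m + 1) = (m + 1).factorial := by
    rw [Nat.factorial_succ]; ring
  simp only [Nat.add_zero, Nat.sub_zero, Nat.factorial_zero, one_mul, h]
  exact Nat.div_self (Nat.factorial_pos _)

theorem ct_succ (m j : ℕ) (h : j ≤ m) :
    (catalanTriangle m (j + 1) : ℤ)
      = ((m + j + 1).choose (j + 1) : ℤ) - ((m + j + 1).choose j : ℤ) := by
  have h1 := Nat.add_choose_mul_factorial_mul_factorial m (j + 1)
  have h2 := Nat.add_choose_mul_factorial_mul_factorial (m + 1) j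
  have e3 : m + 1 + j = m + (j + 1) := by omega
  rw [e3] at h2
  obtain ⟨d, rfl⟩ := Nat.exists_eq_add_of_le h
  rw [add_assoc (j + d) j 1]
  set A := (j + d + (j + 1)).choose (j + 1)
  set B := (j + d + (j + 1)).choose j
  have key : (j + d + (j + 1)).factorial * d + B * ((j + 1).factorial * (j + d + 1).factorial)
      = A * ((j + 1).factorial * (j + d + 1).factorial) := by
    have a1 : A * ((j + 1).factorial * (j + d + 1).factorial)
        = (j + d + (j + 1)).factorial * (j + d + 1) := by
      rw [← h1, Nat.factorial_succ (j + d)]; ring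
    have a2 : B * ((j + 1).factorial * (j + d + 1).factorial)
        = (j + d + (j + 1)).factorial * (j + 1) := by
      rw [← h2, Nat.factorial_succ j]; ring
    rw [a1, a2]; ring
  have hp : 0 < (j + 1).factorial * (j + d + 1).factorial := by positivity
  have hBA : B ≤ A := by
    refine Nat.le_of_mul_le_mul_right ?_ hp
    omega
  obtain ⟨N, hN⟩ := Nat.exists_eq_add_of_le hBA
  have : catalanTriangle (j + d) (j + 1) = N := by
    unfold catalanTriangle
    have e4 : j + d + 1 - (j + 1) = d := by omega
    rw [e4]
    apply Nat.div_eq_of_eq_mul_left hp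
    rw [hN, add_mul] at key
    omega
  rw [this, hN]; push_cast; ring

theorem ct_rec (m j : ℕ) (h : j ≤ m) :
    (catalanTriangle (m + 1) (j + 1) : ℤ)
      = catalanTriangle (m + 1) j + catalanTriangle m (j + 1) := by
  rw [ct_succ _ _ (by omega), ct_succ _ _ h]
  rcases j with _ | i
  · rw [ct_zero]; simp; ring
  · rw [ct_succ _ _ (by omega)]
    have e1 : m + 1 + (i + 1) + 1 = (m + i + 2) + 1 := by omega
    have e2 : m + (i + 1) + 1 = m + i + 2 := by omega
    have e3 : m + 1 + i + 1 = m + i + 2 := by omega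
    rw [e1, e2, e3, Nat.choose_succ_succ (m + i + 2) (i + 1),
      Nat.choose_succ_succ (m + i + 2) i]
    push_cast; ring

theorem ct_top (m : ℕ) : catalanTriangle m (m + 1) = 0 := by
  simp [catalanTriangle]

theorem ct_diag (m : ℕ) :
    (m + 2 : ℤ) * catalanTriangle (m + 1) (m + 1) = (m + 1).centralBinom := by
  rw [ct_succ _ _ (by omega), Nat.centralBinom]
  have h := Nat.choose_succ_right_eq (2 * (m + 1)) m
  have e : 2 * (m + 1) - m = m + 2 := by omega
  rw [e] at h
  have e1 : m + 1 + m + 1 = 2 * (m + 1) := by omega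
  rw [e1]
  zify at h
  linarith

theorem ct_sum (m : ℕ) :
    ∑ s ∈ Finset.range (m + 1), (catalanTriangle m s : ℤ) * 2 ^ (m + 1 - s)
      = (m + 1).centralBinom := by
  induction m with
  | zero => simp [ct_zero, Nat.centralBinom]
  | succ m ih =>
    set F := ∑ s ∈ Finset.range (m + 1 + 1), (catalanTriangle (m + 1) s : ℤ) * 2 ^ (m + 1 + 1 - s)
      with hF
    have hA : F = ∑ s ∈ Finset.range (m + 1), (catalanTriangle (m + 1) s : ℤ) * 2 ^ (m + 2 - s)
        + 2 * catalanTriangle (m + 1) (m + 1) := by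
      rw [hF, Finset.sum_range_succ]
      have : m + 1 + 1 - (m + 1) = 1 := by omega
      rw [this]; ring
    have hB : F = ∑ s ∈ Finset.range (m + 1), (catalanTriangle (m + 1) s : ℤ) * 2 ^ (m + 1 - s)
        + (∑ s ∈ Finset.range (m + 1), (catalanTriangle m (s + 1) : ℤ) * 2 ^ (m + 1 - s)
          + 2 ^ (m + 2)) := by
      rw [hF, Finset.sum_range_succ', ← add_assoc, ← Finset.sum_add_distrib, ct_zero]
      congr 1
      · apply Finset.sum_congr rfl
        intro s hs
        rw [ct_rec _ _ (by simp at hs; omega)]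
        have : m + 1 + 1 - (s + 1) = m + 1 - s := by omega
        rw [this]; ring
      · simp
    have hC : ∑ s ∈ Finset.range (m + 1), (catalanTriangle m (s + 1) : ℤ) * 2 ^ (m + 1 - s)
          + 2 ^ (m + 2) = 2 * ((m + 1).centralBinom : ℤ) := by
      rw [← ih, Finset.sum_range_succ, ct_top, Finset.sum_range_succ' _ m, ct_zero, mul_add,
        Finset.mul_sum]
      simp only [Nat.cast_zero, zero_mul, add_zero]
      congr 1
      · apply Finset.sum_congr rfl
        intro s hs
        have : m + 1 - s = (m + 1 - (s + 1)) + 1 := by simp at hs; omega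
        rw [this, pow_succ]; ring
      · simp; ring
    have hD : ∑ s ∈ Finset.range (m + 1), (catalanTriangle (m + 1) s : ℤ) * 2 ^ (m + 2 - s)
        = 2 * ∑ s ∈ Finset.range (m + 1), (catalanTriangle (m + 1) s : ℤ) * 2 ^ (m + 1 - s) := by
      rw [Finset.mul_sum]
      apply Finset.sum_congr rfl
      intro s hs
      have : m + 2 - s = (m + 1 - s) + 1 := by simp at hs; omega
      rw [this, pow_succ]; ring
    have hF2 : F = 4 * ((m + 1).centralBinom : ℤ) - 2 * catalanTriangle (m + 1) (m + 1) := by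
      rw [hC] at hB
      linarith
    have hd := ct_diag m
    have hcb := Nat.succ_mul_centralBinom_succ (m + 1)
    zify at hcb
    have hne : (m + 2 : ℤ) ≠ 0 := by positivity
    apply mul_left_cancel₀ hne
    rw [hF2]
    linear_combination (-2 : ℤ) * hd - hcb

theorem stmt_5 (n : ℕ) (hn : 1 ≤ n) :
    (2 * n).choose n = ∑ s ∈ Finset.range n, catalanTriangle (n - 1) s * 2 ^ (n - s) ∧
    (∑ s ∈ Finset.range n, catalanTriangle (n - 1) s * 2 ^ (n - s)) =
      ∑ s ∈ Finset.range (n + 1), (n.choose s) ^ 2 := by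
  obtain ⟨m, rfl⟩ : ∃ m, n = m + 1 := ⟨n - 1, by omega⟩
  have h : (2 * (m + 1)).choose (m + 1)
      = ∑ s ∈ Finset.range (m + 1), catalanTriangle (m + 1 - 1) s * 2 ^ (m + 1 - s) := by
    have := ct_sum m
    rw [Nat.centralBinom] at this
    rw [Nat.add_sub_cancel]
    exact_mod_cast this.symm
  refine ⟨h, ?_⟩
  rw [← h, Nat.sum_range_choose_sq]
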